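/- (Lemma 2.1, finite-dimensional Kalman-rank form.) Let N ≥ 1 be an integer and let λ₁ < λ₂ < ⋯ < λ_N be real numbers. For each n ∈ {1,…,N}, let ψ_n : [0,1] → ℝ be twice continuously differentiable, not identically zero, and satisfy (p(x)ψ_n′(x))′ − q(x)ψ_n(x) = −λ_n r(x) ψ_n(x) for all x ∈ [0,1], with b₁ψ_n(0) + b₂ψ_n′(0) = 0 and a₁ψ_n(1) + a₂ψ_n′(1) = 0. Let μ₁ > 0 with μ₁ ≠ λ_n for all n ∈ {1,…,N}, and let φ₁ : [0,1] → ℝ be twice continuously differentiable with (p(x)φ₁′(x))′ − q(x)φ₁(x) = −μ₁ r(x) φ₁(x) for all x ∈ [0,1], b₁φ₁(0) + b₂φ₁′(0) = 0 and a₁φ₁(1) + a₂φ₁′(1) = 1. Define C := diag(−λ₁,…,−λ_N) ∈ ℝ^{N×N} and B₁ ∈ ℝ^N with entries (B₁)_n := −∫₀¹ r(x) φ₁(x) ψ_n(x) dx. Then the Kalman controllability matrix [B₁ | C B₁ | ⋯ | C^{N−1} B₁] ∈ ℝ^{N×N} is invertible; in particular the pair (C, B₁) is controllable. -/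

import Mathlib

/- STATEMENT 5 (Lemma 2.1, Kalman-rank form): with C = diag(-λ₁,…,-λ_N) and
(B₁)_n = -∫₀¹ r φ₁ ψ_n, the Kalman controllability matrix [B₁ | CB₁ | ⋯ | C^{N-1}B₁]
is invertible. -/

open Set

/-- The differential equation `(p y')' - q y = -l r y` on `[0, 1]`, in the form of
derivatives of `y` and of the flux `p y'`. -/
lemma hasDerivWithinAt_of_sturmLiouville {p q r y : ℝ → ℝ} {l : ℝ}
    (hp : ContDiffOn ℝ 1 p (Icc 0 1)) (hy : ContDiffOn ℝ 2 y (Icc 0 1))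
    (hode : ∀ x ∈ Icc (0:ℝ) 1,
      derivWithin (fun t => p t * derivWithin y (Icc 0 1) t) (Icc 0 1) x
        - q x * y x = -l * (r x * y x)) {x : ℝ} (hx : x ∈ Icc (0:ℝ) 1) :
    HasDerivWithinAt y (derivWithin y (Icc 0 1) x) (Icc 0 1) x ∧
    HasDerivWithinAt (fun t => p t * derivWithin y (Icc 0 1) t)
      ((q x - l * r x) * y x) (Icc 0 1) x := by
  have hu : UniqueDiffOn ℝ (Icc (0:ℝ) 1) := uniqueDiffOn_Icc zero_lt_one
  have hy' : ContDiffOn ℝ 1 (derivWithin y (Icc 0 1)) (Icc 0 1) :=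
    hy.derivWithin hu (by norm_num [one_add_one_eq_two])
  refine ⟨(hy.differentiableOn (by norm_num) x hx).hasDerivWithinAt, ?_⟩
  have h := ((hp.mul hy').differentiableOn (by norm_num) x hx).hasDerivWithinAt
  refine h.congr_deriv ?_
  change derivWithin (fun t => p t * derivWithin y (Icc 0 1) t) (Icc 0 1) x = _
  linarith [hode x hx]

/-- A solution of a homogeneous Sturm-Liouville equation with vanishing Cauchy data at `1`
vanishes identically. -/
lemma sturmLiouville_eq_zero {p q r y : ℝ → ℝ} {l : ℝ}
    (hp : ContDiffOn ℝ 1 p (Icc 0 1)) (hppos : ∀ x ∈ Icc (0:ℝ) 1, 0 < p x)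
    (hq : ContinuousOn q (Icc 0 1)) (hr : ContinuousOn r (Icc 0 1))
    (hy : ContDiffOn ℝ 2 y (Icc 0 1))
    (hode : ∀ x ∈ Icc (0:ℝ) 1,
      derivWithin (fun t => p t * derivWithin y (Icc 0 1) t) (Icc 0 1) x
        - q x * y x = -l * (r x * y x))
    (h1 : y 1 = 0) (h1' : derivWithin y (Icc 0 1) 1 = 0) :
    ∀ x ∈ Icc (0:ℝ) 1, y x = 0 := by
  obtain ⟨K₁, hK₁⟩ := isCompact_Icc.exists_bound_of_continuousOn
    (hp.continuousOn.inv₀ fun x hx => (hppos x hx).ne')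
  obtain ⟨K₂, hK₂⟩ := isCompact_Icc.exists_bound_of_continuousOn
    (hq.sub (continuousOn_const (c := l) |>.mul hr))
  let K : NNReal := (max K₁ K₂).toNNReal
  let v : ℝ → ℝ × ℝ → ℝ × ℝ := fun t z => ((p t)⁻¹ * z.2, (q t - l * r t) * z.1)
  let f : ℝ → ℝ × ℝ := fun t => (y t, p t * derivWithin y (Icc 0 1) t)
  have hd : ∀ t ∈ Icc (0:ℝ) 1, HasDerivWithinAt f (v t (f t)) (Icc 0 1) t := by
    intro t ht
    obtain ⟨hd₁, hd₂⟩ := hasDerivWithinAt_of_sturmLiouville hp hy hode ht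
    convert hd₁.prodMk hd₂ using 2
    exact inv_mul_cancel_left₀ (hppos t ht).ne' _
  have hv : ∀ t ∈ Ioc (0:ℝ) 1, LipschitzOnWith K (v t) univ := by
    intro t ht
    have ht' := Ioc_subset_Icc_self ht
    have hb₁ : |(p t)⁻¹| ≤ K :=
      (hK₁ t ht').trans ((le_max_left _ _).trans (Real.le_coe_toNNReal _))
    have hb₂ : |q t - l * r t| ≤ K :=
      (hK₂ t ht').trans ((le_max_right _ _).trans (Real.le_coe_toNNReal _))
    refine LipschitzOnWith.of_dist_le_mul fun z _ w _ => ?_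
    rw [Prod.dist_eq, Prod.dist_eq]
    simp only [v, Real.dist_eq, ← mul_sub, abs_mul]
    refine max_le ?_ ?_
    · gcongr
      exact le_max_right _ _
    · gcongr
      exact le_max_left _ _
  have hzero : ∀ t, v t 0 = 0 := fun t => by simp [v]
  have heq : EqOn f (fun _ => 0) (Icc 0 1) :=
    ODE_solution_unique_of_mem_Icc_left hv
      (fun t ht => (hd t ht).continuousWithinAt)
      (fun t ht => (hd t (Ioc_subset_Icc_self ht)).mono_of_mem_nhdsWithin
        (Icc_mem_nhdsLE_of_mem ht))
      (fun _ _ => mem_univ _) continuousOn_const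
      (fun t _ => by rw [hzero]; exact hasDerivWithinAt_const _ _ _)
      (fun _ _ => mem_univ _) (by simp [f, h1, h1'])
  exact fun x hx => congrArg Prod.fst (heq hx)

/-- Lagrange's identity for two solutions of a Sturm-Liouville equation with different spectral
parameters. -/
lemma sturmLiouville_lagrange {p q r y z : ℝ → ℝ} {l m : ℝ}
    (hp : ContDiffOn ℝ 1 p (Icc 0 1)) (hr : ContinuousOn r (Icc 0 1))
    (hy : ContDiffOn ℝ 2 y (Icc 0 1)) (hz : ContDiffOn ℝ 2 z (Icc 0 1))
    (hodey : ∀ x ∈ Icc (0:ℝ) 1,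
      derivWithin (fun t => p t * derivWithin y (Icc 0 1) t) (Icc 0 1) x
        - q x * y x = -m * (r x * y x))
    (hodez : ∀ x ∈ Icc (0:ℝ) 1,
      derivWithin (fun t => p t * derivWithin z (Icc 0 1) t) (Icc 0 1) x
        - q x * z x = -l * (r x * z x)) :
    (l - m) * ∫ x in (0:ℝ)..1, r x * y x * z x =
      p 1 * (derivWithin y (Icc 0 1) 1 * z 1 - y 1 * derivWithin z (Icc 0 1) 1) -
      p 0 * (derivWithin y (Icc 0 1) 0 * z 0 - y 0 * derivWithin z (Icc 0 1) 0) := by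
  have hd : ∀ x ∈ Icc (0:ℝ) 1, HasDerivWithinAt
      (fun t => (p t * derivWithin y (Icc 0 1) t) * z t - y t * (p t * derivWithin z (Icc 0 1) t))
      ((l - m) * (r x * y x * z x)) (Icc 0 1) x := by
    intro x hx
    obtain ⟨hy₁, hy₂⟩ := hasDerivWithinAt_of_sturmLiouville hp hy hodey hx
    obtain ⟨hz₁, hz₂⟩ := hasDerivWithinAt_of_sturmLiouville hp hz hodez hx
    exact ((hy₂.mul hz₁).sub (hy₁.mul hz₂)).congr_deriv (by ring)
  have hc : ContinuousOn (fun x => (l - m) * (r x * y x * z x)) (Icc 0 1) :=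
    continuousOn_const.mul ((hr.mul hy.continuousOn).mul hz.continuousOn)
  have h := intervalIntegral.integral_eq_sub_of_hasDerivAt_of_le zero_le_one
    (fun x hx => (hd x hx).continuousWithinAt)
    (fun x hx => (hd x (Ioo_subset_Icc_self hx)).hasDerivAt (Icc_mem_nhds hx.1 hx.2))
    (hc.intervalIntegrable_of_Icc zero_le_one)
  rw [intervalIntegral.integral_const_mul] at h
  rw [h]
  ring

/-- The Kalman matrix of a diagonal matrix is a scaled Vandermonde matrix. -/
lemma det_kalman_diagonal_ne_zero {N : ℕ} {d b : Fin N → ℝ}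
    (hd : Function.Injective d) (hb : ∀ n, b n ≠ 0) :
    (Matrix.of fun n k : Fin N => ((Matrix.diagonal d ^ (k : ℕ)).mulVec b) n).det ≠ 0 := by
  have h : (Matrix.of fun n k : Fin N => ((Matrix.diagonal d ^ (k : ℕ)).mulVec b) n) =
      Matrix.diagonal b * Matrix.vandermonde d := by
    ext n k
    simp [Matrix.diagonal_pow, Matrix.mulVec_diagonal, Matrix.vandermonde_apply, mul_comm]
  rw [h, Matrix.det_mul, Matrix.det_diagonal]
  exact mul_ne_zero (Finset.prod_ne_zero_iff.2 fun n _ => hb n)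
    (Matrix.det_vandermonde_ne_zero_iff.2 hd)

theorem stmt_5
    (p q r : ℝ → ℝ)
    (a₁ a₂ b₁ b₂ : ℝ) (ha : a₁ ^ 2 + a₂ ^ 2 = 1) (hb : b₁ ^ 2 + b₂ ^ 2 = 1)
    (hp : ContDiffOn ℝ 1 p (Set.Icc 0 1))
    (hppos : ∀ x ∈ Set.Icc (0:ℝ) 1, 0 < p x)
    (hq : ContinuousOn q (Set.Icc 0 1))
    (hr : ContinuousOn r (Set.Icc 0 1))
    (hrpos : ∀ x ∈ Set.Icc (0:ℝ) 1, 0 < r x)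
    (N : ℕ) (hN : 1 ≤ N)
    (lam : Fin N → ℝ) (hlam : StrictMono lam)
    (ψ : Fin N → ℝ → ℝ)
    (hψ : ∀ n, ContDiffOn ℝ 2 (ψ n) (Set.Icc 0 1))
    (hψnz : ∀ n, ∃ x ∈ Set.Icc (0:ℝ) 1, ψ n x ≠ 0)
    (hodeψ : ∀ n, ∀ x ∈ Set.Icc (0:ℝ) 1,
      derivWithin (fun t => p t * derivWithin (ψ n) (Set.Icc 0 1) t) (Set.Icc 0 1) x
        - q x * ψ n x = -lam n * (r x * ψ n x))
    (hbcψ0 : ∀ n, b₁ * ψ n 0 + b₂ * derivWithin (ψ n) (Set.Icc 0 1) 0 = 0)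
    (hbcψ1 : ∀ n, a₁ * ψ n 1 + a₂ * derivWithin (ψ n) (Set.Icc 0 1) 1 = 0)
    (μ₁ : ℝ) (hμ₁ : 0 < μ₁) (hμ₁ne : ∀ n, μ₁ ≠ lam n)
    (φ₁ : ℝ → ℝ)
    (hφ₁ : ContDiffOn ℝ 2 φ₁ (Set.Icc 0 1))
    (hodeφ₁ : ∀ x ∈ Set.Icc (0:ℝ) 1,
      derivWithin (fun t => p t * derivWithin φ₁ (Set.Icc 0 1) t) (Set.Icc 0 1) x
        - q x * φ₁ x = -μ₁ * (r x * φ₁ x))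
    (hbcφ₁0 : b₁ * φ₁ 0 + b₂ * derivWithin φ₁ (Set.Icc 0 1) 0 = 0)
    (hbcφ₁1 : a₁ * φ₁ 1 + a₂ * derivWithin φ₁ (Set.Icc 0 1) 1 = 1)
    (C : Matrix (Fin N) (Fin N) ℝ)
    (hC : C = Matrix.diagonal (fun n => -lam n))
    (B₁ : Fin N → ℝ)
    (hB₁ : ∀ n, B₁ n = -(∫ x in (0:ℝ)..1, r x * φ₁ x * ψ n x)) :
    (Matrix.of fun n k : Fin N => ((C ^ (k : ℕ)).mulVec B₁) n).det ≠ 0 ∧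
    IsUnit (Matrix.of fun n k : Fin N => ((C ^ (k : ℕ)).mulVec B₁) n) := by
  have hdet : (Matrix.of fun n k : Fin N => ((C ^ (k : ℕ)).mulVec B₁) n).det ≠ 0 := by
    subst hC
    refine det_kalman_diagonal_ne_zero (neg_injective.comp hlam.injective) fun n hBn => ?_
    have hint : ∫ x in (0:ℝ)..1, r x * φ₁ x * ψ n x = 0 := by linarith [hB₁ n]
    have hL := sturmLiouville_lagrange hp hr hφ₁ (hψ n) hodeφ₁ (hodeψ n)
    rw [hint, mul_zero] at hL
    have hψ0 := hbcψ0 n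
    have hψ1 := hbcψ1 n
    obtain ⟨x, hx, hxne⟩ := hψnz n
    have hp1 := (hppos 1 (by simp)).ne'
    generalize derivWithin φ₁ (Icc 0 1) 0 = φ0' at *
    generalize derivWithin (ψ n) (Icc 0 1) 0 = ψ0' at *
    have hW0 : φ0' * ψ n 0 - φ₁ 0 * ψ0' = 0 := by
      linear_combination (-(φ0' * ψ n 0 - φ₁ 0 * ψ0')) * hb +
        (b₁ * φ0' - b₂ * φ₁ 0) * hψ0 - (b₁ * ψ0' - b₂ * ψ n 0) * hbcφ₁0
    have hW1 : derivWithin φ₁ (Icc 0 1) 1 * ψ n 1 -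
        φ₁ 1 * derivWithin (ψ n) (Icc 0 1) 1 = 0 := by
      rw [hW0, mul_zero, sub_zero] at hL
      exact (mul_eq_zero.1 hL.symm).resolve_left hp1
    refine hxne (sturmLiouville_eq_zero hp hppos hq hr (hψ n) (hodeψ n) ?_ ?_ x hx)
    · linear_combination (-ψ n 1) * hbcφ₁1 + φ₁ 1 * hψ1 + a₂ * hW1
    · linear_combination (-derivWithin (ψ n) (Icc 0 1) 1) * hbcφ₁1 +
        derivWithin φ₁ (Icc 0 1) 1 * hψ1 - a₁ * hW1
  exact ⟨hdet, (Matrix.isUnit_iff_isUnit_det _).2 hdet.isUnit⟩
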